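/- Let M₁, M₂ be matroids on a common finite ground set X, let p ≥ 2 be an integer, and let A, B be common independent sets (possibly of different cardinalities). Then there exist nonempty sets P₁, ..., P_m ⊆ X with |P_i ∩ A| ≤ p and |P_i ∩ B| ≤ p − 1, and coefficients λ_i > 0, such that (i) A Δ P_i is a common independent set for every i, and (ii) ∑_i λ_i·χ^{P_i} = (p/(p−1))·χ^{A\B} + χ^{B\A}. -/

import Mathlib

open Finset

lemma alt_perm {U : Type*} [Fintype U] [DecidableEq U] (Q : U → U → Prop) (hQ : ∀ x, Q x x)
    (S : Finset U) (hS : S.Nonempty) (h : ∀ i ∈ S, ∃ x ∈ S, Q x i ∧ x ≠ i) :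
    ∃ ψ : Equiv.Perm U, ψ ≠ 1 ∧ ∀ i, Q (ψ i) i := by
  classical
  have h' : ∀ i, ∃ x, Q x i ∧ (i ∈ S → x ∈ S ∧ x ≠ i) := by
    intro i
    by_cases hi : i ∈ S
    · obtain ⟨x, hx, hq, hne⟩ := h i hi
      exact ⟨x, hq, fun _ => ⟨hx, hne⟩⟩
    · exact ⟨i, hQ i, fun h => absurd h hi⟩
  choose g hg hgS using h'
  have hit : ∀ i ∈ S, ∀ n, g^[n] i ∈ S := by
    intro i hi n
    induction n with
    | zero => exact hi
    | succ n ih => rw [Function.iterate_succ_apply']; exact (hgS _ ih).1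
  obtain ⟨i, hi⟩ := hS
  obtain ⟨m, n, hmn, heq⟩ : ∃ m n : ℕ, m < n ∧ g^[m] i = g^[n] i := by
    obtain ⟨m, n, hne, heq⟩ := Finite.exists_ne_map_eq_of_infinite (fun n : ℕ => g^[n] i)
    rcases lt_or_gt_of_ne hne with hlt | hlt
    · exact ⟨m, n, hlt, heq⟩
    · exact ⟨n, m, hlt, heq.symm⟩
  have hper : g^[m] i ∈ Function.periodicPts g := by
    refine Function.mk_mem_periodicPts (n := n - m) (by omega) ?_
    unfold Function.IsPeriodicPt Function.IsFixedPt
    rw [← Function.iterate_add_apply, Nat.sub_add_cancel hmn.le, heq]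
  have hb := Function.bijOn_periodicPts g
  let k : U → U := fun x => if x ∈ Function.periodicPts g then g x else x
  have hk : Function.Injective k := by
    intro x y hxy
    simp only [k] at hxy
    split_ifs at hxy with hx hy hy
    · exact hb.injOn hx hy hxy
    · exact absurd (hxy ▸ hb.mapsTo hx) hy
    · exact absurd (hxy ▸ hb.mapsTo hy) hx
    · exact hxy
  refine ⟨Equiv.ofBijective k (Finite.injective_iff_bijective.1 hk), ?_, ?_⟩
  · intro he
    have h1 : k (g^[m] i) = g^[m] i := by
      have := congrArg (fun e : Equiv.Perm U => e (g^[m] i)) he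
      simpa using this
    simp only [k, if_pos hper] at h1
    exact (hgS _ (hit i hi m)).2 h1
  · intro j
    simp only [Equiv.ofBijective_apply, k]
    split_ifs
    · exact hg j
    · exact hQ j

lemma perm_decomp {U : Type*} [Fintype U] [DecidableEq U] (σ τ : Equiv.Perm U) (h : σ ≠ τ) :
    ∃ (s : Finset U) (W : U → Finset U) (c : ℝ), 0 ≤ c ∧
      (∀ x ∈ s, (W x).card < Fintype.card U ∧ ∃ ρ : U → U, Set.InjOn ρ (W x) ∧
        Set.MapsTo ρ (W x) (W x) ∧ ∀ y, ρ y = σ y ∨ ρ y = τ y) ∧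
      ∀ y, c * ∑ x ∈ s, (if y ∈ W x then (1 : ℝ) else 0) = 1 := by
  classical
  by_cases hc : ∃ x y, ¬ σ.SameCycle x y
  · obtain ⟨x, y, hxy⟩ := hc
    have hne : x ≠ y := by rintro rfl; exact hxy (Equiv.Perm.SameCycle.refl _ _)
    let O : Finset U := univ.filter (fun z => σ.SameCycle x z)
    refine ⟨{x, y}, fun z => if z = x then O else Oᶜ, 1, zero_le_one, ?_, ?_⟩
    · intro z hz
      simp only [mem_insert, mem_singleton] at hz
      constructor
      · apply Finset.card_lt_univ_of_notMem (x := if z = x then y else x)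
        rcases hz with rfl | rfl
        · simp [O, hxy]
        · simp [O, hne.symm, Equiv.Perm.SameCycle.refl]
      · refine ⟨σ, σ.injective.injOn, ?_, fun _ => Or.inl rfl⟩
        intro w
        dsimp only
        split_ifs <;> simp [O]
    · intro w
      rw [Finset.sum_pair hne]
      by_cases hw : σ.SameCycle x w <;> simp [O, hw, hne.symm]
  · push Not at hc
    have hex : ∀ x y, ∃ k : ℕ, (σ ^ k) x = y := fun x y => by
      obtain ⟨k, -, hk⟩ := (hc x y).exists_pow_eq'
      exact ⟨k, hk⟩
    have hex' : ∀ x, ∃ k : ℕ, (σ ^ k) (τ x) = x := fun x => hex _ _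
    let d : U → ℕ := fun x => Nat.find (hex' x)
    have hd : ∀ x, (σ ^ (d x)) (τ x) = x := fun x => Nat.find_spec (hex' x)
    have hmin : ∀ x k, k < d x → (σ ^ k) (τ x) ≠ x := fun x k hk => Nat.find_min (hex' x) hk
    let W : U → Finset U := fun x => (range (d x + 1)).image (fun k => (σ ^ k) (τ x))
    have hW : ∀ x y, y ∈ W x ↔ ∃ k ≤ d x, (σ ^ k) (τ x) = y := by
      intro x y; simp [W]
    have f1 : ∀ x y, y ≠ x → y ∈ W x → σ y ∈ W x := by
      intro x y hne hy
      obtain ⟨k, hk, rfl⟩ := (hW _ _).1 hy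
      have : k ≠ d x := by rintro rfl; exact hne (hd x)
      exact (hW _ _).2 ⟨k + 1, by omega, by rw [pow_succ']; rfl⟩
    have f2 : ∀ x y, σ y ≠ τ x → σ y ∈ W x → y ∈ W x := by
      intro x y hne hy
      obtain ⟨k, hk, hky⟩ := (hW _ _).1 hy
      cases k with
      | zero => exact absurd hky.symm hne
      | succ k =>
        rw [pow_succ', Equiv.Perm.mul_apply] at hky
        exact (hW _ _).2 ⟨k, by omega, σ.injective hky⟩
    have f3 : ∀ x y, y ≠ x → y ∈ W x → σ y ≠ τ x := by
      intro x y hne hy he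
      obtain ⟨k, hk, rfl⟩ := (hW _ _).1 hy
      have hkd : k ≠ d x := by rintro rfl; exact hne (hd x)
      have hp : (σ ^ (k + 1)) (τ x) = τ x := by rw [pow_succ']; exact he
      have := hd x
      have h2 : (σ ^ (d x - (k + 1))) (τ x) = x := by
        conv_lhs => rw [← hp]
        rw [← Equiv.Perm.mul_apply, ← pow_add, Nat.sub_add_cancel (by omega)]
        exact hd x
      exact hmin x _ (by omega) h2
    have f4 : ∀ x, σ x ≠ τ x → σ x ∉ W x := by
      intro x hne hy
      obtain ⟨k, hk, hky⟩ := (hW _ _).1 hy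
      cases k with
      | zero => exact hne hky.symm
      | succ k =>
        rw [pow_succ', Equiv.Perm.mul_apply] at hky
        exact hmin x k (by omega) (σ.injective hky)
    have fx : ∀ x, x ∈ W x := fun x => (hW _ _).2 ⟨d x, le_rfl, hd x⟩
    have ft : ∀ x, τ x ∈ W x := fun x => (hW _ _).2 ⟨0, Nat.zero_le _, rfl⟩
    let s : Finset U := univ.filter (fun x => σ x ≠ τ x)
    let cov : U → ℝ := fun y => ∑ x ∈ s, (if y ∈ W x then (1 : ℝ) else 0)
    have hstep : ∀ y, cov (σ y) = cov y := by
      intro y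
      have e : ∀ x, (if σ y ∈ W x then (1 : ℝ) else 0) - (if x = τ.symm (σ y) then 1 else 0)
          = (if y ∈ W x then (1 : ℝ) else 0) - (if x = y then 1 else 0) := by
        intro x
        have hiff : x = τ.symm (σ y) ↔ σ y = τ x := by
          rw [Equiv.eq_symm_apply]; exact eq_comm
        simp only [hiff]
        by_cases h1 : y = x
        · subst h1
          by_cases h2 : σ y = τ y
          · simp [h2, ft, fx]
          · simp [h2, fx, f4 _ h2]
        · by_cases h2 : σ y = τ x
          · have h3 : y ∉ W x := fun h4 => f3 x y h1 h4 h2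
            simp [h2, ft, h3, Ne.symm h1]
          · have h3 : σ y ∈ W x ↔ y ∈ W x := ⟨f2 x y h2, f1 x y h1⟩
            simp [h2, h3, Ne.symm h1]
      have e2 := Finset.sum_congr (rfl : s = s) (fun x _ => e x)
      rw [Finset.sum_sub_distrib, Finset.sum_sub_distrib, Finset.sum_ite_eq', Finset.sum_ite_eq'] at e2
      have e3 : τ.symm (σ y) ∈ s ↔ y ∈ s := by
        simp only [s, mem_filter, mem_univ, true_and, Equiv.apply_symm_apply, ne_eq,
          σ.injective.eq_iff, Equiv.symm_apply_eq]
      simp only [e3] at e2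
      simp only [cov]
      linarith
    have hpow : ∀ (k : ℕ) y, cov ((σ ^ k) y) = cov y := by
      intro k y
      induction k with
      | zero => simp
      | succ k ih => rw [pow_succ', Equiv.Perm.mul_apply, hstep, ih]
    obtain ⟨x0, hx0⟩ : ∃ x, σ x ≠ τ x := by
      by_contra! hh
      exact h (Equiv.ext hh)
    have hpos : 0 < cov x0 := by
      apply Finset.sum_pos'
      · intro i _; split_ifs <;> norm_num
      · exact ⟨x0, by simp [s, hx0], by simp [fx]⟩
    refine ⟨s, W, (cov x0)⁻¹, by positivity, ?_, ?_⟩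
    · intro x hx
      have hx' : σ x ≠ τ x := by simpa [s] using hx
      refine ⟨Finset.card_lt_univ_of_notMem (f4 x hx'), fun y => if y = x then τ x else σ y,
        ?_, ?_, ?_⟩
      · intro y hy z hz hyz
        simp only at hyz
        split_ifs at hyz with h1 h2 h2
        · rw [h1, h2]
        · exact absurd hyz.symm (f3 x z h2 hz)
        · exact absurd hyz (f3 x y h1 hy)
        · exact σ.injective hyz
      · intro y hy
        simp only
        split_ifs with h1
        · exact ft x
        · exact f1 x y h1 hy
      · intro y
        simp only
        split_ifs with h1
        · right; rw [h1]
        · left; rfl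
    · intro y
      obtain ⟨k, rfl⟩ := hex x0 y
      have := hpow k x0
      change (cov x0)⁻¹ * cov _ = 1
      rw [this, inv_mul_cancel₀ hpos.ne']

lemma mem_cl_of_dep {α : Type*} (M : Matroid α) {A S : Set α} (hA : M.Indep A) (hS : S.Nonempty)
    {e : α} (he : e ∈ M.E)
    (h : ∀ i ∈ S, ¬ M.Indep (insert e (A \ {i}))) : e ∈ M.closure (A \ S) := by
  have h1 : A \ S = ⋂ i ∈ S, A \ {i} := by
    obtain ⟨s, hs⟩ := hS
    ext x
    simp only [Set.mem_sdiff, Set.mem_iInter, Set.mem_singleton_iff]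
    constructor
    · rintro ⟨hx, hxS⟩ i hi
      exact ⟨hx, fun h => hxS (h ▸ hi)⟩
    · intro hx
      exact ⟨(hx s hs).1, fun h => (hx x h).2 rfl⟩
  rw [h1, Matroid.closure_biInter_eq_biInter_closure_of_biUnion_indep hS]
  · simp only [Set.mem_iInter]
    intro i hi
    by_contra hc
    exact h i hi (((hA.subset Set.sdiff_subset).insert_indep_iff).2 (Or.inl ⟨he, hc⟩))
  · refine hA.subset ?_
    simp only [Set.iUnion_subset_iff]
    intro i _
    exact Set.sdiff_subset

lemma strong_indep {α U : Type*} [DecidableEq U] (M : Matroid α) {A : Set α} (hA : M.Indep A)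
    (a f : U → α) (ha : ∀ u, a u ∈ A) (hf : ∀ u, f u ∉ A) (hinj : Function.Injective a)
    (hr : ∀ u, M.Indep (insert (f u) (A \ {a u})))
    (hs : ∀ S : Finset U, S.Nonempty →
      ∃ i ∈ S, ∀ x ∈ S, M.Indep (insert (f i) (A \ {a x})) → x = i) :
    ∀ (n : ℕ) (S : Finset U), S.card = n → M.Indep ((A \ a '' S) ∪ f '' S) := by
  intro n
  induction n with
  | zero =>
    intro S hS
    rw [Finset.card_eq_zero] at hS
    subst hS
    simpa using hA
  | succ n ih =>
    intro S hS
    have hne : S.Nonempty := by rw [← Finset.card_pos]; omega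
    obtain ⟨i, hi, hiS⟩ := hs S hne
    have hA' := ih (S.erase i) (by rw [Finset.card_erase_of_mem hi, hS]; rfl)
    have hSi : (S : Set U) = insert i (S.erase i : Set U) := by
      rw [← Finset.coe_insert, Finset.insert_erase hi]
    have hfE : f i ∈ M.E := (hr i).subset_ground (Set.mem_insert _ _)
    by_cases hem : (S.erase i).Nonempty
    · have h1 : f i ∈ M.closure (A \ (a '' (S.erase i : Set U))) := by
        apply mem_cl_of_dep M hA (by obtain ⟨x, hx⟩ := hem; exact ⟨a x, x, hx, rfl⟩) hfE
        rintro _ ⟨x, hx, rfl⟩ hI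
        have hx' := Finset.mem_erase.1 hx
        exact hx'.1 (hiS x hx'.2 hI)
      have h2 : f i ∉ M.closure (A \ a '' S) := by
        have h3 : f i ∉ M.closure (A \ {a i}) := by
          have := ((hA.subset Set.sdiff_subset).insert_indep_iff (e := f i)).1 (hr i)
          rcases this with h | h
          · exact h.2
          · exact absurd h.1 (hf i)
        intro h4
        refine h3 (M.closure_subset_closure ?_ h4)
        intro x hx
        exact ⟨hx.1, fun h => hx.2 ⟨i, hi, h.symm⟩⟩
      have hai : a i ∉ a '' (S.erase i : Set U) := by
        rintro ⟨x, hx, hxi⟩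
        exact (Finset.mem_erase.1 hx).1 (hinj hxi)
      have h5 : A \ a '' (S.erase i : Set U) = insert (a i) (A \ a '' S) := by
        ext x
        rw [hSi, Set.image_insert_eq]
        simp only [Set.mem_sdiff, Set.mem_insert_iff]
        constructor
        · rintro ⟨h, h'⟩
          by_cases hx : x = a i
          · exact Or.inl hx
          · exact Or.inr ⟨h, by tauto⟩
        · rintro (rfl | h)
          · exact ⟨ha i, hai⟩
          · exact ⟨h.1, by tauto⟩
      rw [h5] at h1 hA'
      have h6 := Matroid.mem_closure_insert h2 h1
      have haX : a i ∉ (A \ a '' S) ∪ f '' (S.erase i : Set U) := by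
        rintro (h | ⟨x, _, hx⟩)
        · exact h.2 ⟨i, hi, rfl⟩
        · exact hf x (hx ▸ ha i)
      rw [Set.insert_union] at hA'
      have hX := hA'.subset (Set.subset_insert _ _)
      have h7 := (hX.insert_indep_iff_of_notMem haX).1 hA'
      rw [hSi, Set.image_insert_eq (f := f), Set.union_insert, ← hSi]
      rw [hX.insert_indep_iff]
      left
      refine ⟨hfE, fun h8 => h7.2 ?_⟩
      rw [← Matroid.closure_insert_eq_of_mem_closure h8]
      exact M.closure_subset_closure (Set.insert_subset_insert Set.subset_union_left) h6
    · rw [Finset.not_nonempty_iff_eq_empty] at hem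
      rw [hSi, hem]
      have := hr i
      rw [Set.insert_eq, Set.union_comm] at this
      simpa using this

lemma hall_exchange {α : Type*} [DecidableEq α] (M : Matroid α) (A B : Finset α)
    (hA : M.Indep (A : Set α)) (hB : M.Indep (B : Set α)) (hc : A.card = B.card) :
    ∃ f : ↥(A \ B) ≃ ↥(B \ A),
      ∀ i : ↥(A \ B), M.Indep (insert (f i : α) ((A : Set α) \ {(i : α)})) := by
  classical
  have hcard : (A \ B).card = (B \ A).card := by
    have h1 := Finset.card_sdiff_add_card_inter A B
    have h2 := Finset.card_sdiff_add_card_inter B A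
    rw [Finset.inter_comm] at h2
    omega
  have key := (Fintype.all_card_le_filter_rel_iff_exists_injective
    (fun (j : ↥(B \ A)) (i : ↥(A \ B)) =>
      M.Indep (insert (j : α) ((A : Set α) \ {(i : α)})))).1 ?_
  · obtain ⟨g, hg, hgr⟩ := key
    have hbij : Function.Bijective g :=
      (Fintype.bijective_iff_injective_and_card g).2 ⟨hg, by simp [hcard]⟩
    refine ⟨(Equiv.ofBijective g hbij).symm, fun i => ?_⟩
    have := hgr ((Equiv.ofBijective g hbij).symm i)
    rwa [Equiv.ofBijective_apply_symm_apply g hbij i] at this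
  · intro T
    by_contra! hlt
    set N : Finset ↥(A \ B) := univ.filter (fun i => ∃ j ∈ T,
      M.Indep (insert (j : α) ((A : Set α) \ {(i : α)}))) with hN
    let C : Finset α := (A ∩ B) ∪ N.map (Function.Embedding.subtype _)
    let D : Finset α := (A ∩ B) ∪ T.map (Function.Embedding.subtype _)
    have hCA : C ⊆ A := by
      intro x hx
      simp only [C, mem_union, mem_inter, mem_map, Function.Embedding.subtype_apply] at hx
      rcases hx with h | ⟨y, _, rfl⟩
      · exact h.1
      · exact (mem_sdiff.1 y.2).1
    have hDB : D ⊆ B := by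
      intro x hx
      simp only [D, mem_union, mem_inter, mem_map, Function.Embedding.subtype_apply] at hx
      rcases hx with h | ⟨y, _, rfl⟩
      · exact h.2
      · exact (mem_sdiff.1 y.2).1
    have hCD : C.card < D.card := by
      simp only [C, D]
      rw [Finset.card_union_of_disjoint, Finset.card_union_of_disjoint, card_map, card_map]
      · omega
      · rw [Finset.disjoint_left]
        intro x hx hx'
        simp only [mem_map, Function.Embedding.subtype_apply] at hx'
        obtain ⟨y, _, rfl⟩ := hx'
        exact (mem_sdiff.1 y.2).2 (mem_inter.1 hx).1
      · rw [Finset.disjoint_left]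
        intro x hx hx'
        simp only [mem_map, Function.Embedding.subtype_apply] at hx'
        obtain ⟨y, _, rfl⟩ := hx'
        exact (mem_sdiff.1 y.2).2 (mem_inter.1 hx).2
    have hCi : M.Indep (C : Set α) := hA.subset (by exact_mod_cast hCA)
    obtain ⟨e, heD, heC, heI⟩ := hCi.augment_finset
      (hB.subset (by exact_mod_cast hDB : (D : Set α) ⊆ B)) hCD
    obtain ⟨j, hjT, rfl⟩ : ∃ j : ↥(B \ A), j ∈ T ∧ (j : α) = e := by
      simp only [D, mem_union, mem_map, Function.Embedding.subtype_apply] at heD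
      rcases heD with h | ⟨y, h, h'⟩
      · exact absurd (mem_union_left _ h) heC
      · exact ⟨y, h, h'⟩
    have hjA : (j : α) ∉ A := (mem_sdiff.1 j.2).2
    by_cases hjI : M.Indep (insert (j : α) (A : Set α))
    · have : N = univ := by
        rw [hN, Finset.filter_eq_self]
        intro i _
        exact ⟨j, hjT, hjI.subset (Set.insert_subset_insert Set.sdiff_subset)⟩
      rw [this, card_univ, Fintype.card_coe, hcard] at hlt
      have := Finset.card_le_univ T
      rw [Fintype.card_coe] at this
      omega
    · have hcl : (j : α) ∈ M.closure ((A : Set α) \ ((A : Set α) \ C)) := by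
        apply mem_cl_of_dep M hA
        · by_contra hemp
          rw [Set.not_nonempty_iff_eq_empty, Set.sdiff_eq_empty] at hemp
          exact hjI (heI.subset (Set.insert_subset_insert hemp))
        · exact heI.subset_ground (Set.mem_insert _ _)
        · rintro i ⟨hiA, hiC⟩ hI
          have hiA' : i ∈ A := by exact_mod_cast hiA
          have hiC' : i ∉ C := by exact_mod_cast hiC
          have hiB : i ∉ B := fun h => hiC' (mem_union_left _ (mem_inter.2 ⟨hiA', h⟩))
          apply hiC'
          apply mem_union_right
          rw [mem_map]
          exact ⟨⟨i, mem_sdiff.2 ⟨hiA', hiB⟩⟩, by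
            rw [hN, mem_filter]; exact ⟨mem_univ _, j, hjT, hI⟩, rfl⟩
      rw [Set.sdiff_sdiff_cancel_left (by exact_mod_cast hCA)] at hcl
      have := (hCi.insert_indep_iff_of_notMem (by exact_mod_cast heC)).1 heI
      exact this.2 hcl

lemma perm_cover {U : Type*} [Fintype U] [DecidableEq U] (σ : Equiv.Perm U) (m : ℕ) (hm : 1 ≤ m) :
    ∃ lam : U → ℝ, (∀ u, 0 ≤ lam u) ∧
      (∀ y, ∑ u, lam u * (if y ∈ (range m).image (fun k => (σ ^ k) u) then (1 : ℝ) else 0) = 1) ∧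
      (∀ y, ∑ u, lam u * (if y ∈ (range (m + 1)).image (fun k => (σ ^ k) u) then (1 : ℝ) else 0)
        ≤ ((m : ℝ) + 1) / m) := by
  classical
  let J : ℕ → U → Finset U := fun n y => (range n).image (fun k => (σ⁻¹ ^ k) y)
  have hJ : ∀ n y u, y ∈ (range n).image (fun k => (σ ^ k) u) ↔ u ∈ J n y := by
    intro n y u
    simp only [J, mem_image, mem_range]
    constructor
    · rintro ⟨k, hk, rfl⟩
      exact ⟨k, hk, by simp [inv_pow]⟩
    · rintro ⟨k, hk, rfl⟩
      exact ⟨k, hk, by simp [inv_pow]⟩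
  have hinv1 : ∀ n y, (J n (σ⁻¹ y)).card = (J n y).card := by
    intro n y
    have : J n (σ⁻¹ y) = (J n y).image (fun z => σ⁻¹ z) := by
      simp only [J, image_image]
      apply image_congr
      intro k _
      simp only [Function.comp]
      rw [← Equiv.Perm.mul_apply, ← Equiv.Perm.mul_apply, ← pow_succ, ← pow_succ']
    rw [this, card_image_of_injective _ (Equiv.injective _)]
  have hinv : ∀ n (k : ℕ) y, (J n ((σ⁻¹ ^ k) y)).card = (J n y).card := by
    intro n k y
    induction k with
    | zero => simp
    | succ k ih => rw [pow_succ', Equiv.Perm.mul_apply, hinv1, ih]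
  have hpos : ∀ y, 0 < (J m y).card := by
    intro y
    rw [card_pos]
    exact ⟨_, mem_image_of_mem _ (mem_range.2 (by omega : 0 < m))⟩
  have hsum : ∀ n y, ∑ u, ((J m u).card : ℝ)⁻¹ *
      (if y ∈ (range n).image (fun k => (σ ^ k) u) then (1 : ℝ) else 0)
      = (J n y).card * ((J m y).card : ℝ)⁻¹ := by
    intro n y
    simp only [hJ, mul_ite, mul_one, mul_zero]
    rw [Finset.sum_ite_mem, univ_inter, ← nsmul_eq_mul]
    apply Finset.sum_eq_card_nsmul
    intro u hu
    simp only [J, mem_image] at hu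
    obtain ⟨k, _, rfl⟩ := hu
    rw [hinv]
  refine ⟨fun u => ((J m u).card : ℝ)⁻¹, fun u => by positivity, fun y => ?_, fun y => ?_⟩
  · rw [hsum, mul_inv_cancel₀]
    have := hpos y
    positivity
  · rw [hsum, ← div_eq_mul_inv]
    have h0 := hpos y
    have h0' : (0 : ℝ) < (J m y).card := by exact_mod_cast h0
    have hm0 : (0 : ℝ) < m := by exact_mod_cast hm
    rw [div_le_div_iff₀ h0' hm0]
    have hle : (J m y).card ≤ m := card_image_le.trans (card_range m).le
    have hins : J (m + 1) y = insert ((σ⁻¹ ^ m) y) (J m y) := by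
      simp only [J, range_add_one, image_insert]
    have hle1 : (J (m + 1) y).card ≤ (J m y).card + 1 := by
      rw [hins]; exact card_insert_le _ _
    have : (J (m + 1) y).card * m ≤ (m + 1) * (J m y).card := by
      rcases hle.lt_or_eq with hlt | heq
      · have : (J (m + 1) y).card = (J m y).card := by
          rw [hins, insert_eq_of_mem]
          have hn : ¬ Set.InjOn (fun k => (σ⁻¹ ^ k) y) (range m : Set ℕ) := by
            intro hinj
            have := card_image_of_injOn hinj
            rw [card_range] at this
            change (J m y).card = m at this
            omega
          obtain ⟨i, j, hij, hj, he⟩ : ∃ i j : ℕ, i < j ∧ j < m ∧ (σ⁻¹ ^ i) y = (σ⁻¹ ^ j) y := by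
            simp only [Set.InjOn] at hn
            push Not at hn
            obtain ⟨i, hi, j, hj, he, hne⟩ := hn
            simp only [coe_range, Set.mem_Iio] at hi hj
            rcases lt_or_gt_of_ne hne with h | h
            · exact ⟨i, j, h, hj, he⟩
            · exact ⟨j, i, h, hi, he.symm⟩
          simp only [J, mem_image, mem_range]
          refine ⟨m - j + i, by omega, ?_⟩
          rw [pow_add, Equiv.Perm.mul_apply, he, ← Equiv.Perm.mul_apply, ← pow_add,
            Nat.sub_add_cancel hj.le]
        rw [this]
        nlinarith
      · rw [heq] at hle1 ⊢
        nlinarith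
    exact_mod_cast this

/-- Characteristic vector. -/
noncomputable def chi {α : Type*} [DecidableEq α] (P : Finset α) : α → ℝ :=
  fun x => if x ∈ P then 1 else 0

lemma chi_eq_sum {α : Type*} [DecidableEq α] (P : Finset α) :
    chi P = ∑ x ∈ P, Pi.single x (1 : ℝ) := by
  ext y
  simp [chi, Finset.sum_apply, Pi.single_apply]

noncomputable def vec {α U : Type*} [DecidableEq α] [Fintype U] (κ : ℝ) (a b : U → α) : α → ℝ :=
  ∑ u, (κ • Pi.single (a u) (1 : ℝ) + Pi.single (b u) (1 : ℝ))

structure Exch {α U : Type*} [DecidableEq α] (M₁ M₂ : Matroid α) (A B : Finset α)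
    (a b : U → α) (σ : Equiv.Perm U) : Prop where
  ia : Function.Injective a
  ib : Function.Injective b
  ma : ∀ u, a u ∈ A \ B
  mb : ∀ u, b u ∈ B \ A
  r2 : ∀ u, M₂.Indep (insert (b u) ((A : Set α) \ {a u}))
  r1 : ∀ u, M₁.Indep (insert (b (σ u)) ((A : Set α) \ {a u}))

lemma Exch.swap {α U : Type*} [DecidableEq α] {M₁ M₂ : Matroid α} {A B : Finset α}
    {a b : U → α} {σ : Equiv.Perm U} (h : Exch M₁ M₂ A B a b σ) :
    Exch M₂ M₁ A B a (fun u => b (σ u)) σ⁻¹ where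
  ia := h.ia
  ib := h.ib.comp σ.injective
  ma := h.ma
  mb := fun u => h.mb _
  r2 := h.r1
  r1 := fun u => by simpa using h.r2 u

lemma vec_swap {α U : Type*} [DecidableEq α] [Fintype U] (κ : ℝ) (a b : U → α)
    (σ : Equiv.Perm U) : vec κ a (fun u => b (σ u)) = vec κ a b := by
  unfold vec
  rw [sum_add_distrib, sum_add_distrib]
  congr 1
  exact Equiv.sum_comp σ (fun u => (Pi.single (b u) (1 : ℝ) : α → ℝ))

open scoped NNReal in
lemma smul_mem_K {α : Type*} (K : Submodule ℝ≥0 (α → ℝ)) {c : ℝ} (hc : 0 ≤ c) {v : α → ℝ}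
    (hv : v ∈ K) : c • v ∈ K := K.smul_mem (⟨c, hc⟩ : ℝ≥0) hv

open scoped NNReal in
lemma exch_step {α U : Type*} [DecidableEq α] [Fintype U] [DecidableEq U] {M₁ M₂ : Matroid α}
    {A B : Finset α} (K : Submodule ℝ≥0 (α → ℝ)) (κ : ℝ)
    {a b : U → α} {σ : Equiv.Perm U} (h : Exch M₁ M₂ A B a b σ)
    (ih : ∀ (W : Finset U) (a b : W → α) (σ : Equiv.Perm W), W.card < Fintype.card U →
      Exch M₁ M₂ A B a b σ → vec κ a b ∈ K)
    (τ : Equiv.Perm U) (hne : σ ≠ τ)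
    (hτ : ∀ u, M₁.Indep (insert (b (τ u)) ((A : Set α) \ {a u}))) : vec κ a b ∈ K := by
  obtain ⟨s, W, c, hc, hW, hsum⟩ := perm_decomp σ τ hne
  have key : vec κ a b = c • ∑ x ∈ s, vec κ (fun u : W x => a u) (fun u : W x => b u) := by
    have e1 : ∀ x, vec κ (fun u : W x => a u) (fun u : W x => b u) =
        ∑ u, (if u ∈ W x then (1 : ℝ) else 0) •
          (κ • Pi.single (a u) (1 : ℝ) + Pi.single (b u) (1 : ℝ)) := by
      intro x
      unfold vec
      refine (Finset.sum_coe_sort (W x) (fun u =>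
        (κ • (Pi.single (a u) (1 : ℝ) : α → ℝ) + (Pi.single (b u) (1 : ℝ) : α → ℝ)))).trans ?_
      simp only [ite_smul, one_smul, zero_smul]
      rw [Finset.sum_ite_mem, univ_inter]
    simp only [e1]
    rw [Finset.sum_comm, Finset.smul_sum]
    unfold vec
    apply Finset.sum_congr rfl
    intro u _
    rw [← Finset.sum_smul, smul_smul, hsum, one_smul]
  rw [key]
  apply smul_mem_K K hc
  apply K.sum_mem
  intro x hx
  obtain ⟨hcard, ρ, hinj, hmaps, hρ⟩ := hW x hx
  have hbij : Function.Bijective (hmaps.restrict ρ _ _) :=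
    Finite.injective_iff_bijective.1 ((Set.MapsTo.restrict_inj hmaps).2 hinj)
  refine ih (W x) _ _ (Equiv.ofBijective _ hbij) hcard ⟨?_, ?_, ?_, ?_, ?_, ?_⟩
  · exact h.ia.comp Subtype.val_injective
  · exact h.ib.comp Subtype.val_injective
  · exact fun u => h.ma _
  · exact fun u => h.mb _
  · exact fun u => h.r2 _
  · intro u
    change M₁.Indep (insert (b (ρ u)) _)
    rcases hρ u with e | e <;> rw [e]
    · exact h.r1 _
    · exact hτ _

open scoped NNReal in
lemma exch_terminal {α U : Type*} [DecidableEq α] [Fintype U] [DecidableEq U] {M₁ M₂ : Matroid α}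
    {A B : Finset α} (K : Submodule ℝ≥0 (α → ℝ)) (m : ℕ) (hm : 1 ≤ m)
    (hA : M₁.Indep (A : Set α) ∧ M₂.Indep (A : Set α))
    (hK : ∀ P : Finset α, (P ∩ A).card ≤ m + 1 → (P ∩ B).card ≤ m →
      M₁.Indep (symmDiff A P : Finset α) → M₂.Indep (symmDiff A P : Finset α) → chi P ∈ K)
    {a b : U → α} {σ : Equiv.Perm U} (h : Exch M₁ M₂ A B a b σ)
    (h1 : ∀ S : Finset U, M₁.Indep (((A : Set α) \ a '' S) ∪ (fun u => b (σ u)) '' S))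
    (h2 : ∀ S : Finset U, M₂.Indep (((A : Set α) \ a '' S) ∪ b '' S)) :
    vec (((m : ℝ) + 1) / m) a b ∈ K := by
  obtain ⟨lam, hlam, hT, hS⟩ := perm_cover σ m hm
  set κ : ℝ := ((m : ℝ) + 1) / m
  let I : ℕ → U → Finset U := fun n u => (range n).image (fun k => (σ ^ k) u)
  let P : U → Finset α := fun u => (I (m + 1) u).image a ∪ (I m u).image (fun u => b (σ u))
  have hIm : ∀ u, I m u ⊆ I (m + 1) u := fun u =>
    image_subset_image (range_subset_range.2 (by omega))
  have hIσ : ∀ u, (I m u).image σ ⊆ I (m + 1) u := by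
    intro u x hx
    simp only [I, mem_image, mem_range, exists_exists_and_eq_and] at hx ⊢
    obtain ⟨k, hk, rfl⟩ := hx
    exact ⟨k + 1, by omega, by rw [pow_succ']; rfl⟩
  have haA : ∀ u, a u ∈ A := fun u => (mem_sdiff.1 (h.ma u)).1
  have haB : ∀ u, a u ∉ B := fun u => (mem_sdiff.1 (h.ma u)).2
  have hbB : ∀ u, b u ∈ B := fun u => (mem_sdiff.1 (h.mb u)).1
  have hbA : ∀ u, b u ∉ A := fun u => (mem_sdiff.1 (h.mb u)).2
  have hcard : ∀ n u, (I n u).card ≤ n := fun n u => by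
    simpa using (card_image_le (s := range n) (f := fun k => (σ ^ k) u))
  have hPA : ∀ u, P u ∩ A ⊆ (I (m + 1) u).image a := by
    intro u x hx
    rw [mem_inter, mem_union] at hx
    rcases hx with ⟨hx | hx, hxA⟩
    · exact hx
    · obtain ⟨y, _, rfl⟩ := mem_image.1 hx
      exact absurd hxA (hbA _)
  have hPB : ∀ u, P u ∩ B ⊆ (I m u).image (fun u => b (σ u)) := by
    intro u x hx
    rw [mem_inter, mem_union] at hx
    rcases hx with ⟨hx | hx, hxB⟩
    · obtain ⟨y, _, rfl⟩ := mem_image.1 hx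
      exact absurd hxB (haB _)
    · exact hx
  have hsd : ∀ u x, x ∈ symmDiff A (P u) →
      (x ∈ A ∧ x ∉ (I (m + 1) u).image a) ∨ x ∈ (I m u).image (fun u => b (σ u)) := by
    intro u x hx
    rw [mem_symmDiff] at hx
    rcases hx with ⟨hx, hx'⟩ | ⟨hx, hx'⟩
    · left
      exact ⟨hx, fun h => hx' (mem_union_left _ h)⟩
    · rcases mem_union.1 hx with hx | hx
      · obtain ⟨y, _, rfl⟩ := mem_image.1 hx
        exact absurd (haA _) hx'
      · exact Or.inr hx
  have hPK : ∀ u, chi (P u) ∈ K := by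
    intro u
    apply hK
    · exact (card_le_card (hPA u)).trans (card_image_le.trans (hcard _ _))
    · exact (card_le_card (hPB u)).trans (card_image_le.trans (hcard _ _))
    · refine (h1 (I m u)).subset ?_
      intro x hx
      rcases hsd u x (by exact_mod_cast hx) with ⟨hx1, hx2⟩ | hx1
      · left
        refine ⟨by exact_mod_cast hx1, ?_⟩
        rintro ⟨y, hy, rfl⟩
        exact hx2 (mem_image_of_mem _ (hIm u (by exact_mod_cast hy)))
      · right
        rw [← coe_image]
        exact_mod_cast hx1
    · refine (h2 ((I m u).image σ)).subset ?_
      intro x hx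
      rcases hsd u x (by exact_mod_cast hx) with ⟨hx1, hx2⟩ | hx1
      · left
        refine ⟨by exact_mod_cast hx1, ?_⟩
        rintro ⟨y, hy, rfl⟩
        exact hx2 (mem_image_of_mem _ (hIσ u (by exact_mod_cast hy)))
      · right
        rw [← coe_image, image_image]
        exact_mod_cast hx1
  have hsing : ∀ u, chi {a u} ∈ K := by
    intro u
    have hsub : symmDiff A {a u} ⊆ A := by
      intro x hx
      rw [mem_symmDiff] at hx
      rcases hx with hx | hx
      · exact hx.1
      · rw [mem_singleton.1 hx.1]; exact haA u
    apply hK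
    · exact (card_le_card inter_subset_left).trans (by simp)
    · exact (card_le_card inter_subset_left).trans (by simpa using hm)
    · exact hA.1.subset (by exact_mod_cast hsub)
    · exact hA.2.subset (by exact_mod_cast hsub)
  have hchiP : ∀ u, chi (P u) = ∑ y, (if y ∈ I (m + 1) u then (1 : ℝ) else 0) •
      (Pi.single (a y) (1 : ℝ) : α → ℝ) + ∑ y, (if y ∈ I m u then (1 : ℝ) else 0) •
      (Pi.single (b (σ y)) (1 : ℝ) : α → ℝ) := by
    intro u
    rw [chi_eq_sum, sum_union]
    · rw [sum_image (fun x _ y _ hxy => h.ia hxy),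
        sum_image (fun x _ y _ hxy => σ.injective (h.ib hxy))]
      simp only [ite_smul, one_smul, zero_smul]
      rw [Finset.sum_ite_mem, Finset.sum_ite_mem, univ_inter, univ_inter]
    · rw [disjoint_left]
      intro x hx hx'
      obtain ⟨y, _, rfl⟩ := mem_image.1 hx
      obtain ⟨z, _, hz⟩ := mem_image.1 hx'
      exact hbA (σ z) (by rw [hz]; exact haA y)
  let cov : U → ℝ := fun y => ∑ u, lam u * (if y ∈ I (m + 1) u then (1 : ℝ) else 0)
  have hsumP : ∑ u, lam u • chi (P u) = ∑ y, cov y • (Pi.single (a y) (1 : ℝ) : α → ℝ)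
      + ∑ y, (Pi.single (b (σ y)) (1 : ℝ) : α → ℝ) := by
    simp only [hchiP, smul_add, sum_add_distrib, smul_sum, smul_smul]
    congr 1
    · rw [sum_comm]
      simp only [← sum_smul, cov]
    · rw [sum_comm]
      apply sum_congr rfl
      intro y _
      rw [← sum_smul, hT, one_smul]
  have hfin : vec κ a b = ∑ u, lam u • chi (P u) + ∑ u, (κ - cov u) • chi {a u} := by
    rw [hsumP, ← vec_swap κ a b σ]
    unfold vec
    simp only [chi_eq_sum, sum_singleton, sub_smul, sum_add_distrib, sum_sub_distrib]
    abel
  rw [hfin]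
  refine K.add_mem (K.sum_mem fun u _ => smul_mem_K K (hlam u) (hPK u))
    (K.sum_mem fun u _ => smul_mem_K K (sub_nonneg.2 (hS u)) (hsing u))

/-- Either the matching given by `f` is the unique one in a strong sense,
or there is a different one. -/
lemma strong_or_alt {U : Type*} [Fintype U] [DecidableEq U] (R : U → U → Prop)
    (σ : Equiv.Perm U) (hσ : ∀ u, R u (σ u)) :
    (∀ S : Finset U, S.Nonempty → ∃ i ∈ S, ∀ x ∈ S, R x (σ i) → x = i) ∨
    ∃ τ : Equiv.Perm U, σ ≠ τ ∧ ∀ u, R u (τ u) := by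
  by_contra! hcon
  obtain ⟨⟨S, hS, hbad⟩, hno⟩ := hcon
  obtain ⟨ψ, hψ, hQ⟩ := alt_perm (fun x y => R x (σ y)) hσ S hS hbad
  obtain ⟨u, hu⟩ := hno (σ * ψ⁻¹) (by
    intro he
    apply hψ
    have := mul_eq_left.1 he.symm
    exact inv_eq_one.1 this)
  apply hu
  have := hQ (ψ⁻¹ u)
  simpa using this

open scoped NNReal in
lemma exch_main {α : Type*} [DecidableEq α] {M₁ M₂ : Matroid α}
    {A B : Finset α} (K : Submodule ℝ≥0 (α → ℝ)) (m : ℕ) (hm : 1 ≤ m)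
    (hA : M₁.Indep (A : Set α) ∧ M₂.Indep (A : Set α))
    (hK : ∀ P : Finset α, (P ∩ A).card ≤ m + 1 → (P ∩ B).card ≤ m →
      M₁.Indep (symmDiff A P : Finset α) → M₂.Indep (symmDiff A P : Finset α) → chi P ∈ K)
    (n : ℕ) : ∀ {U : Type _} [Fintype U] [DecidableEq U]
    (a b : U → α) (σ : Equiv.Perm U) (_ : Fintype.card U = n) (_ : Exch M₁ M₂ A B a b σ),
    vec (((m : ℝ) + 1) / m) a b ∈ K := by
  induction n using Nat.strong_induction_on with
  | _ n ih =>
  intro U _ _ a b σ hn h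
  have haA : ∀ u, a u ∈ (A : Set α) := fun u => by exact_mod_cast (mem_sdiff.1 (h.ma u)).1
  have hbA : ∀ u, b u ∉ (A : Set α) := fun u => by exact_mod_cast (mem_sdiff.1 (h.mb u)).2
  rcases strong_or_alt (fun x y => M₁.Indep (insert (b y) ((A : Set α) \ {a x}))) σ h.r1
    with hs1 | ⟨τ, hne, hτ⟩
  · rcases strong_or_alt (fun x y => M₂.Indep (insert (b (σ y)) ((A : Set α) \ {a x}))) σ⁻¹
      h.swap.r1 with hs2 | ⟨τ, hne, hτ⟩
    · refine exch_terminal K m hm hA hK h ?_ ?_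
      · intro S
        exact strong_indep M₁ hA.1 a (fun u => b (σ u)) haA (fun u => hbA _) h.ia h.r1 hs1 _ S rfl
      · intro S
        refine strong_indep M₂ hA.2 a b haA hbA h.ia h.r2 ?_ _ S rfl
        simpa using hs2
    · rw [← vec_swap _ a b σ]
      refine exch_step K _ h.swap ?_ τ hne hτ
      intro W a' b' σ' hW h'
      rw [← vec_swap _ a' b' σ']
      exact ih W.card (hn ▸ hW) _ _ σ'⁻¹ (by simp) h'.swap
  · refine exch_step K _ h ?_ τ hne hτ
    intro W a' b' σ' hW h'
    exact ih W.card (hn ▸ hW) _ _ σ' (by simp) h'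

open scoped NNReal in
lemma equal_card {α : Type*} [DecidableEq α] {M₁ M₂ : Matroid α}
    {A B : Finset α} (K : Submodule ℝ≥0 (α → ℝ)) (m : ℕ) (hm : 1 ≤ m)
    (hA : M₁.Indep (A : Set α) ∧ M₂.Indep (A : Set α))
    (hB : M₁.Indep (B : Set α) ∧ M₂.Indep (B : Set α)) (hc : A.card = B.card)
    (hK : ∀ P : Finset α, (P ∩ A).card ≤ m + 1 → (P ∩ B).card ≤ m →
      M₁.Indep (symmDiff A P : Finset α) → M₂.Indep (symmDiff A P : Finset α) → chi P ∈ K) :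
    (((m : ℝ) + 1) / m) • chi (A \ B) + chi (B \ A) ∈ K := by
  obtain ⟨f1, hf1⟩ := hall_exchange M₁ A B hA.1 hB.1 hc
  obtain ⟨f2, hf2⟩ := hall_exchange M₂ A B hA.2 hB.2 hc
  have := exch_main K m hm hA hK _ (fun u : ↥(A \ B) => (u : α)) (fun u => (f2 u : α))
    (f1.trans f2.symm) rfl ⟨Subtype.val_injective, Subtype.val_injective.comp f2.injective,
      fun u => u.2, fun u => (f2 u).2, hf2, fun u => by simpa using hf1 u⟩
  convert this using 1
  unfold vec
  rw [sum_add_distrib, ← smul_sum, chi_eq_sum, chi_eq_sum]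
  congr 1
  · rw [Finset.sum_coe_sort (A \ B) (fun u => (Pi.single u (1 : ℝ) : α → ℝ))]
  · rw [Equiv.sum_comp f2 (fun u => (Pi.single (u : α) (1 : ℝ) : α → ℝ)),
      Finset.sum_coe_sort (B \ A) (fun u => (Pi.single u (1 : ℝ) : α → ℝ))]

open scoped NNReal in
theorem stmt_8 {X : Type*} [Fintype X] [DecidableEq X]
    (M₁ M₂ : Matroid X) (p : ℕ) (hp : 2 ≤ p) (A B : Finset X)
    (hA : M₁.Indep ↑A ∧ M₂.Indep ↑A) (hB : M₁.Indep ↑B ∧ M₂.Indep ↑B) :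
    ∃ (m : ℕ) (P : Fin m → Finset X) (lam : Fin m → ℝ),
      (∀ i, (P i).Nonempty) ∧
      (∀ i, (P i ∩ A).card ≤ p) ∧
      (∀ i, (P i ∩ B).card ≤ p - 1) ∧
      (∀ i, 0 < lam i) ∧
      (∀ i, M₁.Indep ↑(symmDiff A (P i)) ∧ M₂.Indep ↑(symmDiff A (P i))) ∧
      (∀ x : X, ∑ i, lam i * (if x ∈ P i then (1 : ℝ) else 0)
        = (p : ℝ) / ((p : ℝ) - 1) * (if x ∈ A \ B then (1 : ℝ) else 0)
          + (if x ∈ B \ A then (1 : ℝ) else 0)) := by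
  obtain ⟨m, rfl⟩ : ∃ m, p = m + 1 := ⟨p - 1, by omega⟩
  let G : Set (Finset X) := {P | P.Nonempty ∧ (P ∩ A).card ≤ m + 1 ∧ (P ∩ B).card ≤ m ∧
    M₁.Indep ↑(symmDiff A P) ∧ M₂.Indep ↑(symmDiff A P)}
  let K : Submodule ℝ≥0 (X → ℝ) := Submodule.span ℝ≥0 (chi '' G)
  let L : (X ⊕ ℕ → ℝ) →ₗ[ℝ≥0] (X → ℝ) := LinearMap.funLeft ℝ≥0 ℝ Sum.inl
  have hind : ∀ (M : Matroid X) (S : Finset (X ⊕ ℕ)),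
      (M.sum (Matroid.freeOn (Set.univ : Set ℕ))).Indep (S : Set (X ⊕ ℕ)) ↔
        M.Indep (S.toLeft : Set X) := by
    intro M S
    rw [Matroid.sum_indep_iff, Matroid.freeOn_indep_iff, and_iff_left (Set.subset_univ _)]
    have : (Sum.inl ⁻¹' (S : Set (X ⊕ ℕ)) : Set X) = (S.toLeft : Set X) := by
      ext x; simp
    rw [this]
  let A' : Finset (X ⊕ ℕ) := A.disjSum (range B.card)
  let B' : Finset (X ⊕ ℕ) := B.disjSum (range A.card)
  have hAl : A'.toLeft = A := by simp [A']
  have hBl : B'.toLeft = B := by simp [B']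
  have hmain : (((m : ℝ) + 1) / m) • chi (A' \ B') + chi (B' \ A') ∈ K.comap L := by
    apply equal_card (M₁ := M₁.sum (Matroid.freeOn Set.univ))
      (M₂ := M₂.sum (Matroid.freeOn Set.univ)) _ m (by omega)
    · rw [hind, hind, hAl]; exact hA
    · rw [hind, hind, hBl]; exact hB
    · simp [A', B', add_comm]
    · intro P hPA hPB h1 h2
      rw [hind] at h1 h2
      have hsd : (symmDiff A' P).toLeft = symmDiff A P.toLeft := by
        ext x; simp [mem_symmDiff, A']
      rw [hsd] at h1 h2
      have hLP : L (chi P) = chi P.toLeft := by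
        ext x; simp [L, chi, LinearMap.funLeft_apply]
      rw [Submodule.mem_comap, hLP]
      by_cases hne : P.toLeft.Nonempty
      · apply Submodule.subset_span
        refine ⟨P.toLeft, ⟨hne, ?_, ?_, h1, h2⟩, rfl⟩
        · have : P.toLeft ∩ A = (P ∩ A').toLeft := by ext x; simp [A']
          rw [this]; exact card_toLeft_le.trans hPA
        · have : P.toLeft ∩ B = (P ∩ B').toLeft := by ext x; simp [B']
          rw [this]; exact card_toLeft_le.trans hPB
      · rw [not_nonempty_iff_eq_empty.1 hne]
        have : chi (∅ : Finset X) = 0 := by ext x; simp [chi]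
        rw [this]; exact K.zero_mem
  have hmain' : (((m : ℝ) + 1) / m) • chi (A \ B) + chi (B \ A) ∈ K := by
    rw [Submodule.mem_comap] at hmain
    convert hmain using 1
    ext x
    simp [L, chi, LinearMap.funLeft_apply, A', B']
  have hrep : ∀ v ∈ K, ∃ (n : ℕ) (P : Fin n → Finset X) (lam : Fin n → ℝ),
      (∀ i, P i ∈ G) ∧ (∀ i, 0 < lam i) ∧ ∑ i, lam i • chi (P i) = v := by
    intro v hv
    obtain ⟨n, c, g, hg⟩ := Submodule.mem_span_set'.1 hv
    have hgG : ∀ i, ∃ P ∈ G, chi P = (g i : X → ℝ) := fun i => (g i).2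
    choose Q hQG hQ using hgG
    let s : Finset (Fin n) := univ.filter (fun i => c i ≠ 0)
    let e := s.equivFin
    refine ⟨s.card, fun i => Q (e.symm i), fun i => (c (e.symm i) : ℝ), fun i => hQG _,
      fun i => ?_, ?_⟩
    · have : c (e.symm i) ≠ 0 := (mem_filter.1 (e.symm i).2).2
      exact_mod_cast pos_iff_ne_zero.2 this
    · rw [Equiv.sum_comp e.symm (fun i : s => (c i : ℝ) • chi (Q i)),
        Finset.sum_coe_sort s (fun i => (c i : ℝ) • chi (Q i)), ← hg]
      rw [Finset.sum_filter_of_ne]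
      · apply sum_congr rfl
        intro i _
        rw [hQ]; rfl
      · intro i _ hi hc0
        apply hi
        simp [hc0]
  obtain ⟨n, P, lam, hG, hlam, hsum⟩ := hrep _ hmain'
  refine ⟨n, P, lam, fun i => (hG i).1, fun i => (hG i).2.1, fun i => ?_, hlam,
    fun i => (hG i).2.2.2, fun x => ?_⟩
  · simpa using (hG i).2.2.1
  · have := congrFun hsum x
    simp only [Finset.sum_apply, Pi.smul_apply, Pi.add_apply, smul_eq_mul, chi] at this
    rw [this]
    push_cast
    rw [add_sub_cancel_right]
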